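/- arXiv:1301.0465 — 2 statements merged into one kernel-verified Lean document; each statement's English description precedes it below -/
import Mathlib

section
/- Let Q ⊆ ℝⁿ be a compact, convex, centrally symmetric set with nonempty interior and ‖·‖_Q its Minkowski gauge, with dual norm ‖·‖_Q*. Suppose p is a norm on ℝⁿ and μ, Δ are constants with 1 ≤ μ ≤ Δ such that: (i) p²/2 is differentiable with p(y)²/2 ≤ p(x)²/2 + D(p²/2)(x)(y − x) + (μ/2)·p(y − x)² for all x, y; and (ii) (‖x‖_Q*)² ≤ p(x)² ≤ (Δ/μ)·(‖x‖_Q*)² for all x ∈ ℝⁿ. Then the function d(x) := p*(x)²/2, where p* is the dual norm of p, is strongly convex with respect to ‖·‖_Q with parameter σ = 1/Δ: d(x + y) ≥ d(x) + ⟨g, y⟩ + (1/(2Δ))·‖y‖_Q² for all x, y ∈ ℝⁿ and any subgradient g of d at x. -/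
open scoped InnerProductSpace

/-- The dual norm of a norm `N` on `ℝⁿ`: `N* y = sup {⟨y, x⟩ : N x ≤ 1}`. -/
noncomputable def dualNorm {n : ℕ} (N : EuclideanSpace ℝ (Fin n) → ℝ)
    (y : EuclideanSpace ℝ (Fin n)) : ℝ :=
  sSup ((fun x => ⟪y, x⟫_ℝ) '' {x | N x ≤ 1})

lemma le_of_forall_pos_le_add_mul {a b c : ℝ} (h : ∀ t : ℝ, 0 < t → a ≤ b + t * c) : a ≤ b := by
  have hc : Filter.Tendsto (fun t : ℝ => b + t * c) (nhdsWithin 0 (Set.Ioi 0)) (nhds b) := by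
    have : Continuous fun t : ℝ => b + t * c := by fun_prop
    simpa using (this.tendsto 0).mono_left nhdsWithin_le_nhds
  exact ge_of_tendsto hc (Filter.eventually_of_mem self_mem_nhdsWithin h)

section SmoothNorm

variable {E : Type*} [AddCommGroup E] [Module ℝ E] {p : E → ℝ} {μ : ℝ} {x : E} {L : E →ₗ[ℝ] ℝ}

lemma apply_le_mul_of_quadratic_upper_bound (hphom : ∀ (c : ℝ) (x), p (c • x) = |c| * p x)
    (hptri : ∀ x y, p (x + y) ≤ p x + p y) (hnn : ∀ x, 0 ≤ p x)
    (hL : ∀ y, p y ^ 2 / 2 ≤ p x ^ 2 / 2 + L (y - x) + μ / 2 * p (y - x) ^ 2) (w : E) :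
    L w ≤ p x * p w := by
  refine le_of_forall_pos_le_add_mul (c := μ / 2 * p w ^ 2) fun t ht => ?_
  have h1 := hL (x + (-t) • w)
  have h2 := hptri (x + (-t) • w) (t • w)
  have hx : x + (-t) • w + t • w = x := by module
  rw [hx, hphom, abs_of_pos ht] at h2
  rw [add_sub_cancel_left, map_smul, smul_eq_mul, hphom, abs_neg, abs_of_pos ht] at h1
  have h3 : p x ^ 2 - 2 * t * (p x * p w) ≤ p (x + (-t) • w) ^ 2 := by
    rcases le_total (t * p w) (p x) with h | h
    · nlinarith [pow_le_pow_left₀ (sub_nonneg.2 h) (sub_le_iff_le_add.2 h2) 2, sq_nonneg (t * p w)]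
    · nlinarith [sq_nonneg (p (x + (-t) • w)), mul_le_mul_of_nonneg_left h (hnn x),
        mul_nonneg (mul_nonneg ht.le (hnn w)) (hnn x)]
  refine le_of_mul_le_mul_left ?_ ht
  linarith

lemma sq_le_apply_of_quadratic_upper_bound (hphom : ∀ (c : ℝ) (x), p (c • x) = |c| * p x)
    (hL : ∀ y, p y ^ 2 / 2 ≤ p x ^ 2 / 2 + L (y - x) + μ / 2 * p (y - x) ^ 2) :
    p x ^ 2 ≤ L x := by
  refine le_of_forall_pos_le_add_mul (c := (μ - 1) / 2 * p x ^ 2) fun t ht => ?_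
  have h1 := hL ((1 + t) • x)
  have hx : (1 + t) • x - x = t • x := by module
  rw [hx, map_smul, smul_eq_mul, hphom, hphom, abs_of_pos ht, abs_of_pos (by linarith)] at h1
  refine le_of_mul_le_mul_left ?_ ht
  linarith

lemma apply_le_of_subgradient_of_quadratic_upper_bound
    (hphom : ∀ (c : ℝ) (x), p (c • x) = |c| * p x)
    (hL : ∀ y, p y ^ 2 / 2 ≤ p x ^ 2 / 2 + L (y - x) + μ / 2 * p (y - x) ^ 2)
    {M : E →ₗ[ℝ] ℝ} (hM : ∀ y, p x ^ 2 / 2 + M (y - x) ≤ p y ^ 2 / 2) (w : E) :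
    L w ≤ M w := by
  refine le_of_forall_pos_le_add_mul (c := μ / 2 * p w ^ 2) fun t ht => ?_
  have h1 := hL (x + (-t) • w)
  have h2 := hM (x + (-t) • w)
  rw [add_sub_cancel_left, map_smul, smul_eq_mul] at h1 h2
  rw [hphom, abs_neg, abs_of_pos ht] at h1
  refine le_of_mul_le_mul_left ?_ ht
  linarith

end SmoothNorm

section DualNorm

variable {n : ℕ} {N : EuclideanSpace ℝ (Fin n) → ℝ}

lemma bddAbove_inner_image_of_norm_le {C : ℝ} (hC : ∀ x, N x ≤ 1 → ‖x‖ ≤ C)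
    (y : EuclideanSpace ℝ (Fin n)) : BddAbove ((fun x => ⟪y, x⟫_ℝ) '' {x | N x ≤ 1}) := by
  refine ⟨‖y‖ * C, ?_⟩
  rintro _ ⟨x, hx, rfl⟩
  exact (real_inner_le_norm y x).trans (mul_le_mul_of_nonneg_left (hC x hx) (norm_nonneg y))

lemma dualNorm_nonneg (h0 : N 0 ≤ 1) {y : EuclideanSpace ℝ (Fin n)}
    (hb : BddAbove ((fun x => ⟪y, x⟫_ℝ) '' {x | N x ≤ 1})) : 0 ≤ dualNorm N y :=
  le_csSup hb ⟨0, h0, inner_zero_right y⟩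

lemma dualNorm_le (h0 : N 0 ≤ 1) {y : EuclideanSpace ℝ (Fin n)} {c : ℝ}
    (h : ∀ x, N x ≤ 1 → ⟪y, x⟫_ℝ ≤ c) : dualNorm N y ≤ c := by
  refine csSup_le ⟨_, Set.mem_image_of_mem _ h0⟩ ?_
  rintro _ ⟨x, hx, rfl⟩
  exact h x hx

lemma inner_le_dualNorm_mul (hhom : ∀ (c : ℝ) (x), N (c • x) = |c| * N x) (hnn : ∀ x, 0 ≤ N x)
    (hdef : ∀ x, N x = 0 → x = 0) {y : EuclideanSpace ℝ (Fin n)}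
    (hb : BddAbove ((fun x => ⟪y, x⟫_ℝ) '' {x | N x ≤ 1})) (x : EuclideanSpace ℝ (Fin n)) :
    ⟪y, x⟫_ℝ ≤ dualNorm N y * N x := by
  rcases (hnn x).eq_or_lt with h | h
  · have hx := hdef x h.symm
    rw [← h, hx, inner_zero_right, mul_zero]
  · have h1 : ⟪y, (N x)⁻¹ • x⟫_ℝ ≤ dualNorm N y := by
      refine le_csSup hb ⟨_, ?_, rfl⟩
      rw [Set.mem_ofPred_eq, hhom, abs_of_pos (inv_pos.2 h), inv_mul_cancel₀ h.ne']
    rwa [real_inner_smul_right, inv_mul_le_iff₀ h, mul_comm] at h1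

lemma norm_le_of_dualNorm_le_one {r : ℝ} (hr : 0 < r) (hN : ∀ x, ‖x‖ ≤ r → N x ≤ 1)
    {y : EuclideanSpace ℝ (Fin n)} (hb : BddAbove ((fun x => ⟪y, x⟫_ℝ) '' {x | N x ≤ 1}))
    (hy : dualNorm N y ≤ 1) : ‖y‖ ≤ r⁻¹ := by
  rcases (norm_nonneg y).eq_or_lt with h | h
  · rw [← h]; positivity
  · have h1 : ⟪y, (r * ‖y‖⁻¹) • y⟫_ℝ ≤ dualNorm N y := by
      refine le_csSup hb ⟨_, hN _ ?_, rfl⟩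
      rw [norm_smul, Real.norm_of_nonneg (by positivity), mul_assoc, inv_mul_cancel₀ h.ne', mul_one]
    rw [real_inner_smul_right, real_inner_self_eq_norm_sq] at h1
    have h2 : r * ‖y‖⁻¹ * ‖y‖ ^ 2 = r * ‖y‖ := by field_simp
    rw [← one_div, le_div_iff₀ hr]
    linarith

end DualNorm

lemma Convex.zero_mem_interior_of_neg_mem {E : Type*} [NormedAddCommGroup E] [NormedSpace ℝ E]
    {Q : Set E} (hQ : Convex ℝ Q) (hsymm : ∀ x ∈ Q, -x ∈ Q) (hint : (interior Q).Nonempty) :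
    (0 : E) ∈ interior Q := by
  obtain ⟨x, hx⟩ := hint
  have := hQ.combo_interior_self_mem_interior hx (hsymm x (interior_subset hx))
    (a := 1 / 2) (b := 1 / 2) (by norm_num) (by norm_num) (by norm_num)
  simpa using this

lemma exists_inner_le_gauge_and_eq {E : Type*} [NormedAddCommGroup E] [InnerProductSpace ℝ E]
    [FiniteDimensional ℝ E] {Q : Set E} (hQ : Convex ℝ Q) (h0 : Q ∈ nhds (0 : E)) (y : E) :
    ∃ u : E, (∀ z, ⟪u, z⟫_ℝ ≤ gauge Q z) ∧ ⟪u, y⟫_ℝ = gauge Q y := by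
  obtain ⟨f, hf, hfle⟩ : ∃ f : E →ₗ[ℝ] ℝ, f y = gauge Q y ∧ ∀ z, f z ≤ gauge Q z := by
    by_cases hy : y = 0
    · exact ⟨0, by simp [hy], fun z => gauge_nonneg z⟩
    let f : E →ₗ.[ℝ] ℝ := LinearPMap.mkSpanSingleton y (gauge Q y) hy
    obtain ⟨F, hF, hFle⟩ := exists_extension_of_le_sublinear f (gauge Q)
      (fun c hc x => by rw [gauge_smul_of_nonneg hc.le, smul_eq_mul])
      (gauge_add_le hQ (absorbent_nhds_zero h0)) (by
        rintro ⟨z, hz⟩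
        obtain ⟨c, rfl⟩ := Submodule.mem_span_singleton.1 hz
        rw [LinearPMap.mkSpanSingleton'_apply, smul_eq_mul]
        rcases le_total 0 c with hc | hc
        · exact (gauge_smul_of_nonneg hc y).ge
        · exact (mul_nonpos_of_nonpos_of_nonneg hc (gauge_nonneg y)).trans (gauge_nonneg _))
    refine ⟨F, ?_, hFle⟩
    have h1 := hF ⟨y, Submodule.mem_span_singleton_self y⟩
    rw [h1]
    exact LinearPMap.mkSpanSingleton_apply ℝ ℝ hy _
  refine ⟨(InnerProductSpace.toDual ℝ E).symm (LinearMap.toContinuousLinearMap f), fun z => ?_, ?_⟩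
  · simpa using hfle z
  · simpa using hf

/-- If `(ℝⁿ, ‖·‖_Q*)` is `Δ`-regular with smoothing norm `p` (i.e. `p²/2` has
`μ`-Lipschitz gradient w.r.t. `p`, and `(‖x‖_Q*)² ≤ p(x)² ≤ (Δ/μ)(‖x‖_Q*)²`), then the
prox function `d = (p*)²/2` is strongly convex w.r.t. the Minkowski gauge `‖·‖_Q` with
parameter `σ = 1/Δ`: for any subgradient `g` of `d` at `x`,
`d (x + y) ≥ d x + ⟨g, y⟩ + (1/(2Δ)) ‖y‖_Q²`. -/
theorem prox_strong_convexity_wrt_gauge {n : ℕ}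
    (Q : Set (EuclideanSpace ℝ (Fin n)))
    (hQcomp : IsCompact Q) (hQconv : Convex ℝ Q)
    (hQsymm : ∀ x ∈ Q, -x ∈ Q) (hQint : (interior Q).Nonempty)
    (p : EuclideanSpace ℝ (Fin n) → ℝ)
    (hphom : ∀ (c : ℝ) (x), p (c • x) = |c| * p x)
    (hptri : ∀ x y, p (x + y) ≤ p x + p y)
    (hpdef : ∀ x, p x = 0 → x = 0)
    (μ Δ : ℝ) (hμ : 1 ≤ μ) (hμΔ : μ ≤ Δ)
    (hdiff : Differentiable ℝ (fun x => p x ^ 2 / 2))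
    (hsmooth : ∀ x y, p y ^ 2 / 2 ≤ p x ^ 2 / 2
        + fderiv ℝ (fun z => p z ^ 2 / 2) x (y - x) + μ / 2 * p (y - x) ^ 2)
    (hcomp : ∀ x, dualNorm (gauge Q) x ^ 2 ≤ p x ^ 2 ∧
        p x ^ 2 ≤ Δ / μ * dualNorm (gauge Q) x ^ 2) :
    ∀ (x y g : EuclideanSpace ℝ (Fin n)),
      (∀ z, dualNorm p x ^ 2 / 2 + ⟪g, z - x⟫_ℝ ≤ dualNorm p z ^ 2 / 2) →
      dualNorm p x ^ 2 / 2 + ⟪g, y⟫_ℝ + 1 / (2 * Δ) * gauge Q y ^ 2 ≤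
        dualNorm p (x + y) ^ 2 / 2 := by
  have hμ0 : 0 < μ := by linarith
  have hΔ0 : 0 < Δ := by linarith
  have hp0 : p 0 = 0 := by simpa using hphom 0 0
  have hnn : ∀ x, 0 ≤ p x := fun x => by
    have h := hptri x ((-1 : ℝ) • x)
    rw [hphom, neg_one_smul, add_neg_cancel, hp0] at h
    norm_num at h
    linarith
  have hQ0 : Q ∈ nhds 0 :=
    mem_interior_iff_mem_nhds.1 (hQconv.zero_mem_interior_of_neg_mem hQsymm hQint)
  have hgQ : ∀ x, gauge Q x ≤ 1 → x ∈ Q := fun x hx => by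
    rw [← hQcomp.isClosed.closure_eq]
    exact (gauge_le_one_iff_mem_closure hQconv hQ0).1 hx
  obtain ⟨C, hC⟩ := hQcomp.isBounded.exists_norm_le
  have hbQ := bddAbove_inner_image_of_norm_le (N := gauge Q) fun x hx => hC x (hgQ x hx)
  have hg0 : gauge Q 0 ≤ 1 := by simp
  obtain ⟨r, hr, hrQ⟩ := Metric.nhds_basis_closedBall.mem_iff.1 hQ0
  have hb := bddAbove_inner_image_of_norm_le (N := p) (C := r⁻¹) fun x hx =>
    norm_le_of_dualNorm_le_one hr
      (fun z hz => gauge_le_one_of_mem (hrQ (mem_closedBall_zero_iff.2 hz))) (hbQ x)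
      ((abs_le_of_sq_le_sq' (hcomp x).1 (hnn x)).2.trans hx)
  have hp1 : p 0 ≤ 1 := by simp [hp0]
  have fenchel : ∀ x v, ⟪x, v⟫_ℝ ≤ dualNorm p x ^ 2 / 2 + p v ^ 2 / 2 := fun x v => by
    nlinarith [inner_le_dualNorm_mul hphom hnn hpdef (hb x) v, sq_nonneg (dualNorm p x - p v)]
  intro x y g hg
  set L := fderiv ℝ (fun z => p z ^ 2 / 2) g
  have hL : ∀ y, p y ^ 2 / 2 ≤ p g ^ 2 / 2 + (L : _ →ₗ[ℝ] ℝ) (y - g) + μ / 2 * p (y - g) ^ 2 :=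
    hsmooth g
  -- Equality in the Fenchel inequality, tested against the gradient of `p ^ 2 / 2` at `g`.
  have heq : p g ^ 2 / 2 + dualNorm p x ^ 2 / 2 ≤ ⟪x, g⟫_ℝ := by
    set z := (InnerProductSpace.toDual ℝ (EuclideanSpace ℝ (Fin n))).symm L
    have hz : ∀ w, ⟪z, w⟫_ℝ = L w := fun w => InnerProductSpace.toDual_symm_apply
    have h1 : p g ^ 2 ≤ L g := sq_le_apply_of_quadratic_upper_bound hphom hL
    have h2 : dualNorm p z ≤ p g := dualNorm_le hp1 fun w hw => by
      have h3 : L w ≤ p g * p w := apply_le_mul_of_quadratic_upper_bound hphom hptri hnn hL w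
      rw [hz]
      exact h3.trans (mul_le_of_le_one_right (hnn g) hw)
    have h4 := pow_le_pow_left₀ (dualNorm_nonneg hp1 (hb z)) h2 2
    have h5 := hg z
    rw [inner_sub_right, real_inner_comm, hz, real_inner_comm] at h5
    linarith
  have hLx : ∀ w, L w ≤ ⟪x, w⟫_ℝ :=
    apply_le_of_subgradient_of_quadratic_upper_bound hphom hL (M := innerₗ _ x) fun v => by
      rw [innerₗ_apply_apply, inner_sub_right]
      linarith [fenchel x v]
  obtain ⟨u, hule, huy⟩ := exists_inner_le_gauge_and_eq hQconv hQ0 y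
  have hu1 : dualNorm (gauge Q) u ≤ 1 := dualNorm_le hg0 fun z hz => (hule z).trans hz
  have hu2 := pow_le_pow_left₀ (dualNorm_nonneg hg0 (hbQ u)) hu1 2
  have hpu : μ * p u ^ 2 ≤ Δ := by
    have h1 : p u ^ 2 ≤ Δ / μ := (hcomp u).2.trans <|
      mul_le_of_le_one_right (by positivity) (by simpa using hu2)
    rwa [le_div_iff₀ hμ0, mul_comm] at h1
  set s := gauge Q y / Δ with hs
  have hfen := fenchel (x + y) (g + s • u)
  have hsm := hL (g + s • u)
  have hlin := hLx (s • u)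
  rw [add_sub_cancel_left, hphom, mul_pow, sq_abs] at hsm
  simp only [inner_add_left, inner_add_right, real_inner_smul_right] at hfen hlin
  rw [real_inner_comm] at huy
  rw [huy, real_inner_comm g y] at hfen
  have hbound : s ^ 2 * (μ * p u ^ 2) ≤ s ^ 2 * Δ := mul_le_mul_of_nonneg_left hpu (sq_nonneg s)
  have hval : s * gauge Q y - s ^ 2 * Δ / 2 = 1 / (2 * Δ) * gauge Q y ^ 2 := by
    rw [hs]; field_simp; ring
  have hcoe : (L : _ →ₗ[ℝ] ℝ) (s • u) = L (s • u) := rfl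
  linarith
end

section
/- Let Δ = {x ∈ ℝⁿ : Σᵢ xᵢ = 1, xᵢ ≥ 0} be the unit simplex and d(x) = log n + Σ_{i=1}^n xᵢ·log xᵢ the entropy prox function (with 0·log 0 = 0). Then d is strongly convex on Δ with parameter 1 with respect to the ℓ₁-norm: for all x, y in the relative interior of Δ, d(y) ≥ d(x) + ⟨∇d(x), y − x⟩ + (1/2)·‖y − x‖₁², and moreover 0 ≤ d(x) ≤ log n for all x ∈ Δ. -/
/-- A rational lower bound for the logarithm, tangent to third order at `1`. -/
lemma div_le_log_of_pos {t : ℝ} (ht : 0 < t) :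
    (5 * t ^ 2 - 4 * t - 1) / (2 * t ^ 2 + 4 * t) ≤ Real.log t := by
  let f : ℝ → ℝ := fun s => Real.log s - (5 * s ^ 2 - 4 * s - 1) / (2 * s ^ 2 + 4 * s)
  have hf : ∀ s : ℝ, 0 < s → HasDerivAt f ((s - 1) ^ 3 / (s ^ 2 * (s + 2) ^ 2)) s := by
    intro s hs
    have hN : HasDerivAt (fun s : ℝ => 5 * s ^ 2 - 4 * s - 1) (10 * s - 4) s := by
      refine ((((hasDerivAt_pow 2 s).const_mul 5).sub
        ((hasDerivAt_id s).const_mul 4)).sub_const 1).congr_deriv ?_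
      push_cast
      ring
    have hD : HasDerivAt (fun s : ℝ => 2 * s ^ 2 + 4 * s) (4 * s + 4) s := by
      refine (((hasDerivAt_pow 2 s).const_mul 2).add
        ((hasDerivAt_id s).const_mul 4)).congr_deriv ?_
      push_cast
      ring
    have hD0 : 2 * s ^ 2 + 4 * s ≠ 0 := by positivity
    refine ((Real.hasDerivAt_log hs.ne').sub (hN.div hD hD0)).congr_deriv ?_
    have : 2 * s ^ 2 + 4 * s = 2 * s * (s + 2) := by ring
    rw [this]
    field_simp
    ring
  suffices f 1 ≤ f t by
    have h1 : f 1 = 0 := by norm_num [f]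
    rw [h1] at this
    exact sub_nonneg.1 this
  rcases le_total t 1 with h | h
  · have hpos : ∀ s ∈ Set.Icc t 1, 0 < s := fun s hs => ht.trans_le hs.1
    refine antitoneOn_of_deriv_nonpos (convex_Icc t 1)
      (fun s hs => (hf s (hpos s hs)).continuousAt.continuousWithinAt)
      (fun s hs => (hf s (hpos s (interior_subset hs))).differentiableAt.differentiableWithinAt)
      (fun s hs => ?_) (Set.left_mem_Icc.2 h) (Set.right_mem_Icc.2 h) h
    have hs' := interior_subset hs
    rw [(hf s (hpos s hs')).deriv]
    exact div_nonpos_of_nonpos_of_nonneg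
      (Odd.pow_nonpos (by decide) (sub_nonpos.2 hs'.2)) (by positivity)
  · have hpos : ∀ s ∈ Set.Icc 1 t, 0 < s := fun s hs => one_pos.trans_le hs.1
    refine monotoneOn_of_deriv_nonneg (convex_Icc 1 t)
      (fun s hs => (hf s (hpos s hs)).continuousAt.continuousWithinAt)
      (fun s hs => (hf s (hpos s (interior_subset hs))).differentiableAt.differentiableWithinAt)
      (fun s hs => ?_) (Set.left_mem_Icc.2 h) (Set.right_mem_Icc.2 h) h
    have hs' := interior_subset hs
    rw [(hf s (hpos s hs')).deriv]
    exact div_nonneg (pow_nonneg (sub_nonneg.2 hs'.1) 3) (by positivity)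

/-- The pointwise estimate behind Pinsker's inequality. -/
lemma sq_div_le_mul_log_sub {a b : ℝ} (ha : 0 < a) (hb : 0 < b) :
    |b - a| ^ 2 / ((2 * b + 4 * a) / 3) ≤ b * (Real.log b - Real.log a) - (b - a) := by
  have h := mul_le_mul_of_nonneg_left (div_le_log_of_pos (div_pos hb ha)) hb.le
  rw [Real.log_div hb.ne' ha.ne'] at h
  have e : b * ((5 * (b / a) ^ 2 - 4 * (b / a) - 1) / (2 * (b / a) ^ 2 + 4 * (b / a)))
      = |b - a| ^ 2 / ((2 * b + 4 * a) / 3) + (b - a) := by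
    have : 2 * (b / a) ^ 2 + 4 * (b / a) = 2 * b * (b + 2 * a) / a ^ 2 := by
      field_simp
      ring
    have h' : 2 * b + 4 * a = 2 * (b + 2 * a) := by ring
    rw [sq_abs, this, h']
    field_simp
    ring
  linarith

/-- Pinsker's inequality for finite probability vectors. -/
lemma sq_sum_abs_sub_le_two_mul_sum {ι : Type*} [Fintype ι] {x y : ι → ℝ}
    (hx : ∑ i, x i = 1) (hx0 : ∀ i, 0 < x i) (hy : ∑ i, y i = 1) (hy0 : ∀ i, 0 < y i) :
    (∑ i, |y i - x i|) ^ 2 ≤ 2 * ∑ i, y i * (Real.log (y i) - Real.log (x i)) := by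
  have h1 := Finset.sq_sum_div_le_sum_sq_div Finset.univ (fun i => |y i - x i|)
    (g := fun i => (2 * y i + 4 * x i) / 3)
    (fun i _ => by have := hx0 i; have := hy0 i; positivity)
  have h2 := Finset.sum_le_sum fun i (_ : i ∈ Finset.univ) =>
    sq_div_le_mul_log_sub (hx0 i) (hy0 i)
  have h3 : ∑ i, (2 * y i + 4 * x i) / 3 = 2 := by
    rw [← Finset.sum_div, Finset.sum_add_distrib, ← Finset.mul_sum, ← Finset.mul_sum, hx, hy]
    norm_num
  rw [h3] at h1
  rw [Finset.sum_sub_distrib, Finset.sum_sub_distrib, hx, hy] at h2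
  linarith

/-- The convex function `t ↦ t * log t` lies above its tangent line at `c⁻¹`. -/
lemma sub_inv_le_mul_log_add {c t : ℝ} (hc : 0 < c) (ht : 0 ≤ t) :
    t - c⁻¹ ≤ t * Real.log t + t * Real.log c := by
  rcases ht.eq_or_lt with rfl | ht
  · simpa using hc.le
  · have h := mul_le_mul_of_nonneg_left
      (Real.one_sub_inv_le_log_of_pos (mul_pos ht hc)) ht.le
    rw [Real.log_mul ht.ne' hc.ne'] at h
    have e : t * (1 - (t * c)⁻¹) = t - c⁻¹ := by
      field_simp
    linarith

/-- The entropy prox function `d x = log n + ∑ i, x i * log (x i)` on the unit simplex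
`Δ = {x : ∑ i, x i = 1, x i ≥ 0}` is strongly convex with parameter `1` with respect to
the `ℓ₁`-norm on the relative interior of `Δ` (with gradient
`∇d(x) = (log (x i) + 1)ᵢ`), and satisfies `0 ≤ d x ≤ log n` on `Δ`. -/
theorem entropy_prox_simplex {n : ℕ} :
    (∀ x y : Fin n → ℝ,
        (∑ i, x i) = 1 → (∀ i, 0 < x i) →
        (∑ i, y i) = 1 → (∀ i, 0 < y i) →
        (Real.log n + ∑ i, x i * Real.log (x i))
            + (∑ i, (Real.log (x i) + 1) * (y i - x i))
            + 1 / 2 * (∑ i, |y i - x i|) ^ 2 ≤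
          Real.log n + ∑ i, y i * Real.log (y i)) ∧
    (∀ x : Fin n → ℝ, (∑ i, x i) = 1 → (∀ i, 0 ≤ x i) →
        0 ≤ Real.log n + ∑ i, x i * Real.log (x i) ∧
        Real.log n + ∑ i, x i * Real.log (x i) ≤ Real.log n) := by
  refine ⟨fun x y hx hx0 hy hy0 => ?_, fun x hx hx0 => ⟨?_, ?_⟩⟩
  · have h := sq_sum_abs_sub_le_two_mul_sum hx hx0 hy hy0
    have e : ∑ i, y i * (Real.log (y i) - Real.log (x i)) = ∑ i, y i * Real.log (y i)
        - ∑ i, x i * Real.log (x i) - ∑ i, (Real.log (x i) + 1) * (y i - x i)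
        + (∑ i, y i - ∑ i, x i) := by
      simp only [← Finset.sum_sub_distrib, ← Finset.sum_add_distrib]
      exact Finset.sum_congr rfl fun i _ => by ring
    rw [hx, hy] at e
    linarith
  · have hn : (0 : ℝ) < n := by
      rcases Nat.eq_zero_or_pos n with rfl | h
      · simp at hx
      · exact_mod_cast h
    have h := Finset.sum_le_sum fun i (_ : i ∈ Finset.univ) => sub_inv_le_mul_log_add hn (hx0 i)
    rw [Finset.sum_sub_distrib, Finset.sum_add_distrib, ← Finset.sum_mul, hx] at h
    simp only [Finset.sum_const, Finset.card_univ, Fintype.card_fin, nsmul_eq_mul,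
      mul_inv_cancel₀ hn.ne'] at h
    linarith
  · have h : ∑ i, x i * Real.log (x i) ≤ 0 := Finset.sum_nonpos fun i _ =>
      Real.mul_log_nonpos (hx0 i)
        (hx ▸ Finset.single_le_sum (fun j _ => hx0 j) (Finset.mem_univ i))
    linarith
end
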